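/- (i) 0 lies in the image of ι_1. (ii) For every integer α₁ ≥ 0, the number 2^{α₁} lies in the image of ι_1 if and only if α₁ ∈ Q. (iii) For all integers α₁, α₂ with 0 ≤ α₁ < α₂ and every odd integer λ ≥ 1, the number λ·2^{α₂} + 2^{α₁} lies in the image of ι_1 if and only if (α₁, α₂) ∈ R. (Equivalently, since an integer a ≥ 0 lies in the image of ι_1 precisely when C(π^(2)(1, χ^(2)(a))) = 1, the sets Q and R completely determine the image of ι_1.) -/

import Mathlib

open List Filter

open scoped Classical

noncomputable section

/-- The curling number of a finite string: the largest `k` such that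
`S = X ++ Y^k` with `Y` nonempty; by convention `curl [] = 1`. -/
def curl (S : List ℕ) : ℕ :=
  max 1 (sSup {k | ∃ X Y : List ℕ, Y ≠ [] ∧ S = X ++ (List.replicate k Y).flatten})

/-- The prefix of length `n` of the level-`m` Gijswijt sequence `A^(m)`. -/
def gPrefix (m : ℕ) : ℕ → List ℕ
  | 0 => []
  | n + 1 => gPrefix m n ++ [max m (curl (gPrefix m n))]

/-- `gij m p` is the `p`-th term (1-indexed) of the level-`m` Gijswijt sequence `A^(m)`. -/
def gij (m p : ℕ) : ℕ := max m (curl (gPrefix m (p - 1)))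

/-- Standing hypothesis: for every `m ≥ 1`, the sets
`{k ≥ 0 : C(A^(m)[1,k]) ≤ m}` and `{k ≥ 0 : C(A^(m+1)[1,k]) ≤ m}` are infinite. -/
def StandingHyp : Prop :=
  ∀ m : ℕ, 1 ≤ m →
    {k : ℕ | curl (gPrefix m k) ≤ m}.Infinite ∧
    {k : ℕ | curl (gPrefix (m + 1) k) ≤ m}.Infinite

/-- Length of `π^(m)(1,x)`: the `x`-th smallest (0-indexed) element of
`{k : C(A^(m)[1,k]) ≤ m}`. -/
def piLen (m x : ℕ) : ℕ := Nat.nth (fun k => curl (gPrefix m k) ≤ m) x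

/-- `π^(m)(1,x)`: the prefix of `A^(m)` with exactly `x` occurrences of `m`
and curling number at most `m`. -/
def piStr (m x : ℕ) : List ℕ := gPrefix m (piLen m x)

/-- `β^(m)(t)`, the length of `B_t^(m)`. -/
def beta (m t : ℕ) : ℕ := piLen m ((m + 1) ^ (t - 1))

/-- `B_t^(m) := π^(m)(1,(m+1)^(t-1))`. -/
def Bstr (m t : ℕ) : List ℕ := piStr m ((m + 1) ^ (t - 1))

/-- `τ^(m)(t)`, the length of `T_t^(m)`. -/
def tau (m t : ℕ) : ℕ := Nat.nth (fun k => curl (gPrefix (m + 1) k) ≤ m) (t - 1)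

/-- `T_t^(m)`: the `t`-th shortest prefix of `A^(m+1)` with curling number at most `m`. -/
def Tstr (m t : ℕ) : List ℕ := gPrefix (m + 1) (tau m t)

/-- `φ^(m)(n)`: the least `p ≥ 1` with `A^(m)(p) = n`. -/
def phi (m n : ℕ) : ℕ := sInf {p : ℕ | 1 ≤ p ∧ gij m p = n}

/-- `t^(m)(n) = 1 + log_{m+1} #\{i ≤ φ^(m)(n) : A^(m)(i) = m\}`. -/
def tfun (m n : ℕ) : ℕ := 1 + Nat.log (m + 1) ((gPrefix m (phi m n)).count m)

/-- `χ^(b)(a)`: read the base-`b` digits of `a` as base-`(b+1)` digits. -/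
def chi (b a : ℕ) : ℕ := Nat.ofDigits (b + 1) (Nat.digits b a)

/-- `ι_m(t)`: read the base-`(m+2)` digits of the number of occurrences of `m+1`
in `T_t^(m)` as base-`(m+1)` digits. -/
def iota (m t : ℕ) : ℕ :=
  Nat.ofDigits (m + 1) (Nat.digits (m + 2) ((Tstr m t).count (m + 1)))

/-- `ι_m⁻¹(p)`: the largest `x ≥ 1` with `ι_m(x) ≤ p`. -/
def iotaInv (m p : ℕ) : ℕ := sSup {x : ℕ | 1 ≤ x ∧ iota m x ≤ p}

/-- `ord_b(n)`: the `b`-adic valuation of `n`. -/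
def ordb (b n : ℕ) : ℕ := sSup {z : ℕ | b ^ z ∣ n}

/-- The largest base-`b` digit of `n`. -/
def maxdigit (b n : ℕ) : ℕ := (Nat.digits b n).foldr max 0

/-- Auxiliary function for the level-`m` expansion: `lexpAux m a k = a_{m+1+k}`. -/
def lexpAux (m a : ℕ) : ℕ → ℕ
  | 0 => a
  | k + 1 => iota (m + 1 + k) (ordb (m + 1 + k) (lexpAux m a k) + 1)

/-- `lexp m a l = a_l`, the `l`-th term of the level-`m` expansion of `a`. -/
def lexp (m a l : ℕ) : ℕ := lexpAux m a (l - (m + 1))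

/-- The last element `n` of `π^(m+1)(1, χ^(m+1)(a))`; the level-`m` expansion
of `a` is `a_{m+1}, …, a_n`. -/
def levelEnd (m a : ℕ) : ℕ := (piStr (m + 1) (chi (m + 1) a)).getLastD 0

/-- `V_m := {v ≥ 0 : C(T_{v+1}^(m+1)) ≤ m}`. -/
def Vset (m : ℕ) : Set ℕ := {v | curl (Tstr (m + 1) (v + 1)) ≤ m}

/-- `Q := {α ≥ 0 : C(T_{α+1}^(2)) = 1}`. -/
def Qset : Set ℕ := {a | curl (Tstr 2 (a + 1)) = 1}

/-- `R := {(a,b) : a ∈ Q, a < b, no suffix S of T_{a+1}^(2) with T_{a+1}^(2)·S = T_{b+1}^(2)}`. -/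
def Rset : Set (ℕ × ℕ) :=
  {p | p.1 ∈ Qset ∧ p.1 < p.2 ∧
    ¬∃ S : List ℕ, S <:+ Tstr 2 (p.1 + 1) ∧ Tstr 2 (p.1 + 1) ++ S = Tstr 2 (p.2 + 1)}

/-- The digit of `x` in base `b` at (1-indexed) position `i`, i.e. the coefficient
of `b^(i-1)`. -/
def digitAt (b x i : ℕ) : ℕ := (Nat.digits b x).getD (i - 1) 0

/-- `u` is the (1-indexed) position of the second nonzero base-`b` digit of `x`
(the first nonzero digit being at position `ord_b(x)+1`). -/
def IsSecondNonzero (b x u : ℕ) : Prop :=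
  ordb b x + 1 < u ∧ digitAt b x u ≠ 0 ∧
    ∀ i, ordb b x + 1 < i → i < u → digitAt b x i = 0

/-- `𝒮_b`: pairs `(a,a')` with `1 ≤ a < a'` such that for some position `y` the
base-`b` digits of `a` and `a'` agree away from `y` and twice the `y`-th digit of `a`
is at least the `y`-th digit of `a'`. -/
def Sset (b : ℕ) : Set (ℕ × ℕ) :=
  {p | 1 ≤ p.1 ∧ p.1 < p.2 ∧
    ∃ y : ℕ, (∀ i, i ≠ y → (Nat.digits b p.1).getD i 0 = (Nat.digits b p.2).getD i 0) ∧
      (Nat.digits b p.2).getD y 0 ≤ 2 * (Nat.digits b p.1).getD y 0}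

/-- The glue string `S_t^(m)`, so that `T_{t+1}^(m) = T_t^(m) ++ glue m t`. -/
def glue (m t : ℕ) : List ℕ := (gPrefix (m + 1) (tau m (t + 1))).drop (tau m t)

/-- The strings `P_t^(m)`: `P_1^(m) = (m)` and `P_{t+1}^(m) = P_t^(m)·B_t^(m)·S_t^(m)`. -/
def Pstr (m : ℕ) : ℕ → List ℕ
  | 0 => []
  | 1 => [m]
  | t + 2 => Pstr m (t + 1) ++ Bstr m (t + 1) ++ glue m (t + 1)

end

/-! ### Curling numbers -/

theorem curl_le_iff {S : List ℕ} {c : ℕ} (hc : 1 ≤ c) :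
    curl S ≤ c ↔ ∀ X Y : List ℕ, S = X ++ (List.replicate (c + 1) Y).flatten → Y = [] := by
  have hmem : ∀ k X Y, Y ≠ [] → S = X ++ (List.replicate k Y).flatten → k ≤ S.length := by
    intro k X Y hY h
    have hl : 1 ≤ Y.length := List.length_pos_iff.2 hY
    have h2 := congrArg List.length h
    simp only [List.length_append, List.length_flatten, List.map_replicate, List.sum_replicate,
      smul_eq_mul] at h2
    nlinarith
  unfold curl
  constructor
  · intro h X Y hS
    by_contra hY
    have hb : BddAbove {k | ∃ X Y : List ℕ, Y ≠ [] ∧ S = X ++ (List.replicate k Y).flatten} :=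
      ⟨S.length, fun k ⟨X, Y, hY, h⟩ => hmem k X Y hY h⟩
    have := le_csSup hb ⟨X, Y, hY, hS⟩
    have := le_trans (le_max_right _ _) h
    omega
  · intro h
    refine max_le hc (csSup_le ⟨0, S, [0], by simp, by simp⟩ ?_)
    rintro k ⟨X, Y, hY, hS⟩
    by_contra hk
    apply hY
    obtain ⟨d, rfl⟩ : ∃ d, k = d + (c + 1) := ⟨k - (c + 1), by omega⟩
    apply h (X ++ (List.replicate d Y).flatten) Y
    rw [hS, List.replicate_add, List.flatten_append, List.append_assoc]

theorem one_le_curl (S : List ℕ) : 1 ≤ curl S := le_max_left _ _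

theorem curl_le_one_iff {S : List ℕ} :
    curl S ≤ 1 ↔ ∀ X Y : List ℕ, S = X ++ Y ++ Y → Y = [] := by
  simp [curl_le_iff le_rfl, List.replicate_succ]

theorem curl_le_two_iff {S : List ℕ} :
    curl S ≤ 2 ↔ ∀ X Y : List ℕ, S = X ++ Y ++ Y ++ Y → Y = [] := by
  simp [curl_le_iff one_le_two, List.replicate_succ]

theorem curl_le_of_suffix {S S' : List ℕ} (h : S <:+ S') : curl S ≤ curl S' := by
  rw [curl_le_iff (one_le_curl S')]
  intro X Y hS
  obtain ⟨Z, rfl⟩ := h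
  exact (curl_le_iff (one_le_curl (Z ++ S))).1 le_rfl (Z ++ X) Y (by
    rw [List.append_assoc, ← hS])

/-! ### Words cut into blocks by a separator -/

/-- The word `c · f 1 · c · f 2 ⋯ c · f n`. -/
def blocks (c : ℕ) (f : ℕ → List ℕ) : ℕ → List ℕ
  | 0 => []
  | n + 1 => blocks c f n ++ c :: f (n + 1)

theorem blocks_add (c : ℕ) (f : ℕ → List ℕ) (s d : ℕ) :
    blocks c f (s + d) = blocks c f s ++ blocks c (fun i => f (s + i)) d := by
  induction d with
  | zero => simp [blocks]
  | succ d ih => rw [← add_assoc, blocks, ih, blocks, List.append_assoc, add_assoc]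

theorem blocks_congr {c : ℕ} {f g : ℕ → List ℕ} {n : ℕ}
    (h : ∀ i, 1 ≤ i → i ≤ n → f i = g i) : blocks c f n = blocks c g n := by
  induction n with
  | zero => rfl
  | succ n ih =>
    rw [blocks, blocks, ih fun i h1 h2 => h i h1 (by omega), h (n + 1) (by omega) le_rfl]

theorem count_blocks {c : ℕ} {f : ℕ → List ℕ} (hf : ∀ i, c ∉ f i) (n : ℕ) :
    (blocks c f n).count c = n := by
  induction n with
  | zero => rfl
  | succ n ih => simp [blocks, ih, List.count_eq_zero.2 (hf (n + 1))]

theorem append_cons_inj_of_notMem_right {c : ℕ} {A A' p p' : List ℕ} (hp : c ∉ p) (hp' : c ∉ p')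
    (h : A ++ c :: p = A' ++ c :: p') : A = A' ∧ p = p' := by
  rcases List.append_eq_append_iff.1 h with ⟨l, h1, h2⟩ | ⟨l, h1, h2⟩
  · cases l with
    | nil => simp_all
    | cons a l => simp only [List.cons_append, List.cons.injEq] at h2; simp_all
  · cases l with
    | nil => simp_all
    | cons a l => simp only [List.cons_append, List.cons.injEq] at h2; simp_all

theorem exists_last {c : ℕ} {l : List ℕ} (h : c ∈ l) : ∃ s t, l = s ++ c :: t ∧ c ∉ t := by
  obtain ⟨a, b, hab, ha⟩ := List.eq_append_cons_of_mem (List.mem_reverse.2 h)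
  refine ⟨b.reverse, a.reverse, ?_, by simpa using ha⟩
  rw [← List.reverse_reverse l, hab]
  simp

theorem suffix_of_notMem {c : ℕ} {A P Q : List ℕ} (hQ : c ∉ Q) (h : Q <:+ A ++ c :: P) :
    Q <:+ P := by
  rcases List.suffix_or_suffix_of_suffix h (List.suffix_append A (c :: P)) with h | h
  · rcases List.suffix_cons_iff.1 h with rfl | h
    · simp at hQ
    · exact h
  · exact absurd (h.subset (by simp)) hQ

theorem eq_blocks_of_append_cons {c : ℕ} {f : ℕ → List ℕ} (hf : ∀ i, c ∉ f i) {n : ℕ}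
    {P L Y : List ℕ} (hP : c ∉ P) (h : blocks c f n ++ c :: P = L ++ c :: Y) :
    ∃ s, n = s + Y.count c ∧ L = blocks c f s ∧
      c :: Y = blocks c (fun i => f (s + i)) (Y.count c) ++ c :: P := by
  induction n generalizing P Y with
  | zero =>
    by_cases hY : c ∈ Y
    · have := congrArg (List.count c) h
      have h1 := List.count_pos_iff.2 hY
      simp [blocks, List.count_eq_zero.2 hP] at this
      omega
    · obtain ⟨h1, rfl⟩ := append_cons_inj_of_notMem_right hP hY h
      exact ⟨0, by simp [List.count_eq_zero.2 hP], h1.symm, by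
        simp [List.count_eq_zero.2 hP, blocks]⟩
  | succ n ih =>
    by_cases hY : c ∈ Y
    · obtain ⟨Y', p, rfl, hp⟩ := exists_last hY
      rw [← List.cons_append, ← List.append_assoc] at h
      obtain ⟨h1, rfl⟩ := append_cons_inj_of_notMem_right hP hp h
      rw [blocks] at h1
      obtain ⟨s, hs, hL, hY'⟩ := ih (hf _) h1
      have hc : (Y' ++ c :: P).count c = Y'.count c + 1 := by
        simp [List.count_eq_zero.2 hP]
      refine ⟨s, by omega, hL, ?_⟩
      rw [hc, blocks, ← List.cons_append, hY', hs, add_assoc]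
    · obtain ⟨h1, rfl⟩ := append_cons_inj_of_notMem_right hP hY h
      exact ⟨n + 1, by simp [List.count_eq_zero.2 hP], h1.symm, by
        simp [List.count_eq_zero.2 hP, blocks]⟩

theorem eq_of_blocks_eq_append {c : ℕ} {f g : ℕ → List ℕ} (hf : ∀ i, c ∉ f i)
    (hg : ∀ i, c ∉ g i) {n d : ℕ} {L : List ℕ} (h : blocks c f n = L ++ blocks c g d) :
    ∃ e, n = e + d ∧ L = blocks c f e ∧ ∀ i, 1 ≤ i → i ≤ d → f (e + i) = g i := by
  induction d generalizing n with
  | zero => exact ⟨n, rfl, by simpa [blocks] using h.symm, by omega⟩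
  | succ d ih =>
    cases n with
    | zero => simp [blocks] at h
    | succ n =>
      rw [blocks, blocks, ← List.append_assoc] at h
      obtain ⟨h1, h2⟩ := append_cons_inj_of_notMem_right (hf _) (hg _) h
      obtain ⟨e, he, hL, hi⟩ := ih h1
      refine ⟨e, by omega, hL, fun i h1 hd => ?_⟩
      rcases Nat.lt_or_ge d i with hlt | hle
      · obtain rfl : i = d + 1 := by omega
        rw [← h2, he, add_assoc]
      · exact hi i h1 hle

/-- The shape of a square suffix, containing the separator, of a word cut into blocks. -/
theorem blocks_square {c : ℕ} {f : ℕ → List ℕ} (hf : ∀ i, c ∉ f i) {n j : ℕ}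
    {P X U Y : List ℕ} (hP : c ∉ P) (hU : c ∉ U) (hj : j = Y.count c + 1)
    (h : blocks c f n ++ c :: P = X ++ (U ++ c :: Y) ++ (U ++ c :: Y)) :
    ∃ e, n + 1 = e + 2 * j ∧ X ++ U = blocks c f e ∧ f (e + j) = P ++ U ∧
      (∀ i, 1 ≤ i → i < j → f (e + i) = f (e + j + i)) ∧
      X ++ (U ++ c :: Y) = blocks c f (e + j - 1) ++ c :: P := by
  rw [← List.append_assoc] at h
  obtain ⟨s, hs, hL, hY⟩ := eq_blocks_of_append_cons hf hP h
  cases s with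
  | zero => simp [blocks] at hL
  | succ s =>
    rw [hY, blocks] at hL
    have hL' : blocks c f s ++ c :: f (s + 1) =
        (X ++ U ++ blocks c (fun i => f (s + 1 + i)) (Y.count c)) ++ c :: (P ++ U) := by
      rw [← hL]; simp
    obtain ⟨h1, h2⟩ := append_cons_inj_of_notMem_right (hf _) (by simp [hP, hU]) hL'
    obtain ⟨e, he, hX, hi⟩ := eq_of_blocks_eq_append hf (fun i => hf _) h1
    obtain ⟨d, hd⟩ : ∃ d, d = Y.count c := ⟨_, rfl⟩
    rw [← hd] at *
    subst he hj
    refine ⟨e, by omega, hX, ?_, ?_, ?_⟩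
    · rw [← h2, add_assoc]
    · intro i h1 hlt
      rw [hi i h1 (by omega)]
      congr 1
    · rw [hY, ← List.append_assoc, ← List.append_assoc, ← h1]
      rfl

/-! ### Divisibility by powers of three -/

theorem dvd_iff_of_padicValNat_eq {a b : ℕ} (ha : a ≠ 0) (hb : b ≠ 0)
    (h : padicValNat 3 a = padicValNat 3 b) (v : ℕ) : 3 ^ v ∣ a ↔ 3 ^ v ∣ b := by
  rw [padicValNat_dvd_iff_le ha, padicValNat_dvd_iff_le hb, h]

theorem padicValNat_three_eq {v a : ℕ} (ha : ¬3 ∣ a) : padicValNat 3 (3 ^ v * a) = v := by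
  have h0 : a ≠ 0 := by rintro rfl; simp at ha
  rw [padicValNat.mul (by positivity) h0, padicValNat.prime_pow,
    padicValNat.eq_zero_of_not_dvd ha, add_zero]

theorem exists_eq_pow_mul {j : ℕ} (hj : j ≠ 0) : ∃ w, j = 3 ^ padicValNat 3 j * w ∧ ¬3 ∣ w := by
  obtain ⟨w, hw⟩ := (padicValNat_dvd_iff_le (p := 3) hj).2 le_rfl
  refine ⟨w, hw, fun ⟨u, hu⟩ => ?_⟩
  have : 3 ^ (padicValNat 3 j + 1) ∣ j := ⟨u, by rw [pow_succ, mul_assoc, ← hu, ← hw]⟩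
  rw [padicValNat_dvd_iff_le hj] at this
  omega

theorem pow_succ_dvd_iff (v q : ℕ) : 3 ^ (v + 1) ∣ 3 ^ v * q ↔ 3 ∣ q := by
  rw [pow_succ]
  exact mul_dvd_mul_iff_left (by positivity)

/-- Among three terms of a progression whose difference `j` has the valuation `v`, all divisible
by `3 ^ v`, exactly one is divisible by `3 ^ (v + 1)`. -/
theorem dvd_progression {n j : ℕ} (hj : j ≠ 0) (hn : 3 ^ padicValNat 3 j ∣ n) :
    let D := fun k => 3 ^ (padicValNat 3 j + 1) ∣ k
    (D n ∨ D (n + j) ∨ D (n + 2 * j)) ∧ ¬(D n ∧ D (n + j)) ∧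
      ¬(D (n + j) ∧ D (n + 2 * j)) := by
  intro D
  obtain ⟨w, hw, h3⟩ := exists_eq_pow_mul hj
  obtain ⟨q, hq⟩ := hn
  have e0 : D n ↔ 3 ∣ q := by rw [← pow_succ_dvd_iff (padicValNat 3 j), ← hq]
  have e1 : D (n + j) ↔ 3 ∣ q + w := by
    rw [← pow_succ_dvd_iff (padicValNat 3 j), mul_add, ← hq, ← hw]
  have e2 : D (n + 2 * j) ↔ 3 ∣ q + 2 * w := by
    rw [← pow_succ_dvd_iff (padicValNat 3 j), mul_add, mul_left_comm, ← hq, ← hw]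
  rw [e0, e1, e2]
  have := Nat.mod_lt q (show 0 < 3 by norm_num)
  have := Nat.mod_lt w (show 0 < 3 by norm_num)
  interval_cases hq3 : q % 3 <;> interval_cases hw3 : w % 3 <;> omega

theorem not_padicValNat_eq_three_terms {n j : ℕ} (hn0 : n ≠ 0) (hj : j ≠ 0)
    (hn : 3 ^ padicValNat 3 j ∣ n) (h1 : padicValNat 3 n = padicValNat 3 (n + j))
    (h2 : padicValNat 3 (n + j) = padicValNat 3 (n + 2 * j)) : False := by
  have h := dvd_progression hj hn
  have d1 := dvd_iff_of_padicValNat_eq hn0 (by omega) h1 (padicValNat 3 j + 1)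
  have d2 := dvd_iff_of_padicValNat_eq (by omega) (by omega) h2 (padicValNat 3 j + 1)
  simp only at h
  tauto

theorem exists_dvd_add {j : ℕ} (hj : j ≠ 0) (e : ℕ) :
    ∃ i, 1 ≤ i ∧ i ≤ j ∧ 3 ^ padicValNat 3 j ∣ e + i := by
  have hle := Nat.le_of_dvd (Nat.pos_of_ne_zero hj)
    ((padicValNat_dvd_iff_le (p := 3) hj).2 le_rfl)
  have hpos : 0 < 3 ^ padicValNat 3 j := by positivity
  generalize 3 ^ padicValNat 3 j = m at *
  have hlt := Nat.mod_lt e hpos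
  refine ⟨m - e % m, by omega, by omega, e / m + 1, ?_⟩
  have := Nat.div_add_mod e m
  rw [mul_add]
  omega

/-! ### The structure of the level-two sequence -/

/-- The string following the `i`-th occurrence of `2` in the level-two sequence. -/
noncomputable def rulerBlock (i : ℕ) : List ℕ := Tstr 2 (padicValNat 3 i + 1)

/-- The prefix of the level-two sequence that consists of its first `n` blocks. -/
noncomputable def rulerPrefix (n : ℕ) : List ℕ := blocks 2 rulerBlock n

theorem length_gPrefix (m n : ℕ) : (gPrefix m n).length = n := by
  induction n with
  | zero => rfl
  | succ n ih => simp [gPrefix, ih]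

theorem le_of_mem_gPrefix {m n a : ℕ} (h : a ∈ gPrefix m n) : m ≤ a := by
  induction n with
  | zero => simp [gPrefix] at h
  | succ n ih =>
    rcases List.mem_append.1 h with h | h
    · exact ih h
    · rw [List.mem_singleton.1 h]
      exact le_max_left _ _

theorem two_notMem_gPrefix_three (n : ℕ) : 2 ∉ gPrefix 3 n := fun h => by
  have := le_of_mem_gPrefix h
  omega

theorem two_notMem_rulerBlock (i : ℕ) : 2 ∉ rulerBlock i := two_notMem_gPrefix_three _

theorem tau_strictMono (hSH : StandingHyp) {m : ℕ} (hm : 1 ≤ m) :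
    StrictMono fun v => tau m (v + 1) :=
  Nat.nth_strictMono (hSH m hm).2

theorem curl_Tstr_le (hSH : StandingHyp) {m : ℕ} (hm : 1 ≤ m) (t : ℕ) : curl (Tstr m t) ≤ m :=
  Nat.nth_mem_of_infinite (hSH m hm).2 (t - 1)

theorem exists_tau_eq {m k : ℕ} (h : curl (gPrefix (m + 1) k) ≤ m) :
    ∃ v, tau m (v + 1) = k :=
  ⟨_, Nat.nth_count (p := fun k => curl (gPrefix (m + 1) k) ≤ m) h⟩

theorem le_of_rulerBlock_eq_append (hSH : StandingHyp) {a b : ℕ} {U : List ℕ}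
    (h : rulerBlock a = rulerBlock b ++ U) : padicValNat 3 b ≤ padicValNat 3 a := by
  have := congrArg List.length h
  simp only [rulerBlock, Tstr, List.length_append, length_gPrefix] at this
  exact (tau_strictMono hSH one_le_two).le_iff_le.1 (by omega)

theorem padicValNat_eq_of_rulerBlock_eq (hSH : StandingHyp) {a b : ℕ}
    (h : rulerBlock a = rulerBlock b) : padicValNat 3 a = padicValNat 3 b :=
  le_antisymm (le_of_rulerBlock_eq_append (U := []) hSH (by simp [h]))
    (le_of_rulerBlock_eq_append (U := []) hSH (by simp [h]))

theorem rulerPrefix_fourth_power (hSH : StandingHyp) {n : ℕ} {P X Y : List ℕ} (hP : 2 ∉ P)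
    (hY : 2 ∈ Y) (h : rulerPrefix n ++ 2 :: P = X ++ Y ++ Y ++ Y ++ Y) : False := by
  obtain ⟨U, V, rfl, hU⟩ := List.eq_append_cons_of_mem hY
  obtain ⟨j, hj⟩ : ∃ j, j = V.count 2 + 1 := ⟨_, rfl⟩
  obtain ⟨e₁, he₁, -, hf₁, hi₁, h₁⟩ := blocks_square two_notMem_rulerBlock hP hU hj h
  obtain ⟨e₂, he₂, -, hf₂, hi₂, h₂⟩ := blocks_square two_notMem_rulerBlock hP hU hj h₁.symm
  obtain ⟨e, he, -, hf, hi, -⟩ := blocks_square two_notMem_rulerBlock hP hU hj h₂.symm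
  obtain rfl : e₂ = e + j := by omega
  obtain rfl : e₁ = e + j + j := by omega
  obtain ⟨i, hi1, hij, hd⟩ := exists_dvd_add (j := j) (by omega) e
  have key : rulerBlock (e + i) = rulerBlock (e + i + j) ∧
      rulerBlock (e + i + j) = rulerBlock (e + i + 2 * j) := by
    rcases hij.lt_or_eq with hlt | rfl
    · rw [show e + i + j = e + j + i by omega, show e + i + 2 * j = e + j + j + i by omega]
      exact ⟨hi i hi1 hlt, hi₂ i hi1 hlt⟩
    · rw [hf, hf₂, show e + i + 2 * i = e + i + i + i by omega, hf₁]
      exact ⟨rfl, rfl⟩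
  exact not_padicValNat_eq_three_terms (by omega) (by omega) hd
    (padicValNat_eq_of_rulerBlock_eq hSH key.1) (padicValNat_eq_of_rulerBlock_eq hSH key.2)

theorem rulerPrefix_cube (hSH : StandingHyp) {n : ℕ} {X Y : List ℕ}
    (hY : 2 ∈ Y) (h : rulerPrefix (n + 1) = X ++ Y ++ Y ++ Y) : False := by
  obtain ⟨U, V, rfl, hU⟩ := List.eq_append_cons_of_mem hY
  obtain ⟨j, hj⟩ : ∃ j, j = V.count 2 + 1 := ⟨_, rfl⟩
  have hP := two_notMem_rulerBlock (n + 1)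
  obtain ⟨e₁, he₁, -, hf₁, hi₁, h₁⟩ := blocks_square two_notMem_rulerBlock hP hU hj h
  obtain ⟨e, he, -, hf, hi, -⟩ := blocks_square two_notMem_rulerBlock hP hU hj h₁.symm
  obtain rfl : e₁ = e + j := by omega
  obtain ⟨i, hi1, hij, hd⟩ := exists_dvd_add (j := j) (by omega) e
  rcases hij.lt_or_eq with hlt | rfl
  · refine not_padicValNat_eq_three_terms (n := e + i) (j := j) (by omega) (by omega) hd
      (padicValNat_eq_of_rulerBlock_eq hSH ?_) (padicValNat_eq_of_rulerBlock_eq hSH ?_)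
    · rw [hi i hi1 hlt, add_right_comm]
    · rw [show e + i + j = e + j + i by omega, hi₁ i hi1 hlt]
      congr 1
      omega
  · have hx : n + 1 = e + i + 2 * i := by omega
    have h12 : padicValNat 3 (e + i) = padicValNat 3 (e + i + i) :=
      padicValNat_eq_of_rulerBlock_eq hSH (hf.trans hf₁.symm)
    have hle := le_of_rulerBlock_eq_append hSH hf
    have hD := dvd_progression (by omega) hd
    have d1 := dvd_iff_of_padicValNat_eq (by omega) (by omega) h12 (padicValNat 3 i + 1)
    have d2 : 3 ^ (padicValNat 3 i + 1) ∣ e + i + 2 * i → 3 ^ (padicValNat 3 i + 1) ∣ e + i := by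
      rw [padicValNat_dvd_iff_le (by omega), padicValNat_dvd_iff_le (by omega), ← hx]
      exact fun h => h.trans hle
    simp only at hD
    tauto

theorem curl_rulerPrefix_le (hSH : StandingHyp) (n : ℕ) : curl (rulerPrefix n) ≤ 2 := by
  rw [curl_le_two_iff]
  intro X Y h
  cases n with
  | zero => simp_all [rulerPrefix, blocks]
  | succ n =>
    by_cases hY : 2 ∈ Y
    · exact (rulerPrefix_cube hSH hY h).elim
    · have hs : Y ++ Y ++ Y <:+ rulerBlock (n + 1) :=
        suffix_of_notMem (A := rulerPrefix n) (c := 2) (by simp [hY]) ⟨X, by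
          rw [← List.append_assoc, ← List.append_assoc, ← h]; rfl⟩
      obtain ⟨X', hX'⟩ := hs
      exact curl_le_two_iff.1 (curl_Tstr_le hSH one_le_two _) X' Y
        (by rw [List.append_assoc, List.append_assoc, ← List.append_assoc Y]; exact hX'.symm)

/-- Two consecutive runs of `j` blocks with the same labels form a square. -/
theorem rulerPrefix_add_eq {e j : ℕ} (h : ∀ i, 1 ≤ i → i ≤ j →
    padicValNat 3 (e + i) = padicValNat 3 (e + j + i)) :
    rulerPrefix (e + 2 * j) = rulerPrefix e ++ blocks 2 (fun i => rulerBlock (e + j + i)) j ++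
      blocks 2 (fun i => rulerBlock (e + j + i)) j := by
  rw [two_mul, ← add_assoc, rulerPrefix, blocks_add, blocks_add,
    blocks_congr (f := fun i => rulerBlock (e + i)) (g := fun i => rulerBlock (e + j + i))]
  · rfl
  · intro i h1 h2
    simp only [rulerBlock, h i h1 h2]

theorem padicValNat_add_eq {v a b i : ℕ} (ha : 3 ^ v ∣ a) (hb : 3 ^ v ∣ b) (h1 : 1 ≤ i)
    (h2 : i < 3 ^ v) : padicValNat 3 (a + i) = padicValNat 3 (b + i) := by
  have key : ∀ a, 3 ^ v ∣ a → padicValNat 3 (a + i) = padicValNat 3 i := by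
    intro a ha
    have hlt : padicValNat 3 i < v := by
      by_contra! h
      have := Nat.le_of_dvd (by omega) ((padicValNat_dvd_iff_le (p := 3) (by omega)).2 h)
      omega
    apply le_antisymm
    · by_contra! h
      have h3 : 3 ^ (padicValNat 3 i + 1) ∣ a + i :=
        (padicValNat_dvd_iff_le (by omega)).2 h
      have h4 := (Nat.dvd_add_right ((pow_dvd_pow 3 hlt).trans ha)).1 h3
      rw [padicValNat_dvd_iff_le (by omega)] at h4
      omega
    · rw [← padicValNat_dvd_iff_le (by omega)]
      exact dvd_add ((pow_dvd_pow 3 hlt.le).trans ha)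
        ((padicValNat_dvd_iff_le (by omega)).2 le_rfl)
  rw [key a ha, key b hb]

theorem two_lt_curl_of_short_block (hSH : StandingHyp) {n i : ℕ}
    (hi : i < tau 2 (padicValNat 3 (n + 1) + 1)) :
    2 < curl (rulerPrefix n ++ 2 :: gPrefix 3 i) := by
  by_contra! hW
  have hP : curl (gPrefix 3 i) ≤ 2 :=
    (curl_le_of_suffix ⟨rulerPrefix n ++ [2], by simp⟩).trans hW
  obtain ⟨u, rfl⟩ := exists_tau_eq (m := 2) hP
  have huv : u < padicValNat 3 (n + 1) := (tau_strictMono hSH one_le_two).lt_iff_lt.1 hi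
  obtain ⟨q, hq⟩ := (padicValNat_dvd_iff_le (p := 3) n.succ_ne_zero).2 (Nat.succ_le_of_lt huv)
  obtain ⟨r, rfl⟩ : ∃ r, q = r + 1 := ⟨q - 1, by
    have : q ≠ 0 := by rintro rfl; simp at hq
    omega⟩
  obtain ⟨M, hM⟩ : ∃ M, 3 ^ u = M + 1 := ⟨3 ^ u - 1, by
    have : 0 < 3 ^ u := by positivity
    omega⟩
  obtain ⟨e, he⟩ : ∃ e, e = 3 ^ u * (3 * r) := ⟨_, rfl⟩
  have hn : n = e + (M + 1) + (M + 1) + M := by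
    have : n + 1 = e + 3 * 3 ^ u := by
      rw [he, show n + 1 = 3 ^ u * 3 * (r + 1) by rw [← pow_succ]; exact hq]
      ring
    omega
  have hblock : ∀ s, 3 ^ u ∣ s → blocks 2 (fun i => rulerBlock (s + i)) M =
      blocks 2 (fun i => rulerBlock (e + i)) M := by
    intro s hs
    refine blocks_congr fun i h1 h2 => ?_
    simp only [rulerBlock]
    rw [padicValNat_add_eq hs ⟨3 * r, he⟩ h1 (by omega)]
  have hdvd : 3 ^ u ∣ e := ⟨3 * r, he⟩
  have hdM : 3 ^ u ∣ e + (M + 1) := by rw [← hM]; exact dvd_add hdvd dvd_rfl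
  have hdMM : 3 ^ u ∣ e + (M + 1) + (M + 1) := by
    nth_rewrite 2 [← hM]; exact dvd_add hdM dvd_rfl
  have e1 : rulerBlock (e + (M + 1)) = Tstr 2 (u + 1) := by
    rw [rulerBlock, he, ← hM, show 3 ^ u * (3 * r) + 3 ^ u = 3 ^ u * (3 * r + 1) by ring,
      padicValNat_three_eq (by omega)]
  have e2 : rulerBlock (e + (M + 1) + (M + 1)) = Tstr 2 (u + 1) := by
    rw [rulerBlock, he, ← hM,
      show 3 ^ u * (3 * r) + 3 ^ u + 3 ^ u = 3 ^ u * (3 * r + 2) by ring,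
      padicValNat_three_eq (by omega)]
  have hW' : rulerPrefix n = rulerPrefix e ++
      (blocks 2 (fun i => rulerBlock (e + i)) M ++ 2 :: Tstr 2 (u + 1)) ++
      (blocks 2 (fun i => rulerBlock (e + i)) M ++ 2 :: Tstr 2 (u + 1)) ++
      blocks 2 (fun i => rulerBlock (e + i)) M := by
    rw [hn, rulerPrefix, blocks_add, hblock _ hdMM, blocks_add, blocks, hblock _ hdM, e2,
      blocks_add, blocks, e1]
    rfl
  have := curl_le_two_iff.1 hW (rulerPrefix e)
    (blocks 2 (fun i => rulerBlock (e + i)) M ++ 2 :: Tstr 2 (u + 1))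
    (by rw [hW']; simp [Tstr])
  simp at this

theorem max_two_curl_eq (hSH : StandingHyp) {n i : ℕ}
    (hi : i < tau 2 (padicValNat 3 (n + 1) + 1)) :
    max 2 (curl (rulerPrefix n ++ 2 :: gPrefix 3 i)) = max 3 (curl (gPrefix 3 i)) := by
  have h3 := two_lt_curl_of_short_block hSH hi
  have hle : curl (gPrefix 3 i) ≤ curl (rulerPrefix n ++ 2 :: gPrefix 3 i) :=
    curl_le_of_suffix ⟨rulerPrefix n ++ [2], by simp⟩
  have hge : curl (rulerPrefix n ++ 2 :: gPrefix 3 i) ≤ max 3 (curl (gPrefix 3 i)) := by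
    obtain ⟨d, hd⟩ : ∃ d, max 3 (curl (gPrefix 3 i)) = d + 3 :=
      ⟨max 3 (curl (gPrefix 3 i)) - 3, by omega⟩
    rw [hd, curl_le_iff (by omega)]
    intro X Y h
    by_cases hY : 2 ∈ Y
    · refine (rulerPrefix_fourth_power hSH (n := n) (X := X ++ (List.replicate d Y).flatten)
        (two_notMem_gPrefix_three i) hY ?_).elim
      rw [h, add_assoc, List.replicate_add]
      simp [List.replicate_succ]
    · have hs : (List.replicate (d + 3 + 1) Y).flatten <:+ gPrefix 3 i :=
        suffix_of_notMem (A := rulerPrefix n) (c := 2) (by simp [hY]) ⟨X, h.symm⟩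
      obtain ⟨X', hX'⟩ := hs
      exact (curl_le_iff (c := d + 3) (by omega)).1 (by omega) X' Y hX'.symm
  omega

theorem rulerPrefix_succ (n : ℕ) : rulerPrefix (n + 1) =
    rulerPrefix n ++ 2 :: gPrefix 3 (tau 2 (padicValNat 3 (n + 1) + 1)) := rfl

theorem gPrefix_of_block (hSH : StandingHyp) {n k i : ℕ} (h : gPrefix 2 k = rulerPrefix n)
    (hi : i ≤ tau 2 (padicValNat 3 (n + 1) + 1)) :
    gPrefix 2 (k + 1 + i) = rulerPrefix n ++ 2 :: gPrefix 3 i := by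
  induction i with
  | zero =>
    change gPrefix 2 k ++ [max 2 (curl (gPrefix 2 k))] = rulerPrefix n ++ [2]
    rw [h, max_eq_left (curl_rulerPrefix_le hSH n)]
  | succ i ih =>
    rw [← add_assoc, gPrefix, ih (by omega), max_two_curl_eq hSH (by omega), gPrefix,
      List.append_assoc, List.cons_append]

theorem exists_gPrefix_eq (hSH : StandingHyp) (n : ℕ) : ∃ k, gPrefix 2 k = rulerPrefix n := by
  induction n with
  | zero => exact ⟨0, rfl⟩
  | succ n ih =>
    obtain ⟨k, hk⟩ := ih
    exact ⟨_, (gPrefix_of_block hSH hk le_rfl).trans (rulerPrefix_succ n).symm⟩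

theorem exists_rulerPrefix_eq (hSH : StandingHyp) {k : ℕ} (h : curl (gPrefix 2 k) ≤ 2) :
    ∃ n, gPrefix 2 k = rulerPrefix n := by
  have key : ∀ k, ∃ n k' i, gPrefix 2 k' = rulerPrefix n ∧ (k = k' ∨
      i < tau 2 (padicValNat 3 (n + 1) + 1) ∧ k = k' + 1 + i) := by
    intro k
    induction k with
    | zero => exact ⟨0, 0, 0, rfl, .inl rfl⟩
    | succ k ih =>
      have hstep : ∀ n k' i, gPrefix 2 k' = rulerPrefix n →
          i ≤ tau 2 (padicValNat 3 (n + 1) + 1) → k + 1 = k' + 1 + i →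
          ∃ n k' i, gPrefix 2 k' = rulerPrefix n ∧ (k + 1 = k' ∨
            i < tau 2 (padicValNat 3 (n + 1) + 1) ∧ k + 1 = k' + 1 + i) := by
        intro n k' i hk' hi hk
        rcases hi.lt_or_eq with hlt | rfl
        · exact ⟨n, k', i, hk', .inr ⟨hlt, hk⟩⟩
        · refine ⟨n + 1, k + 1, 0, ?_, .inl rfl⟩
          rw [hk, gPrefix_of_block hSH hk' le_rfl, rulerPrefix_succ]
      obtain ⟨n, k', i, hk', rfl | ⟨hi, rfl⟩⟩ := ih
      · exact hstep n k 0 hk' (Nat.zero_le _) rfl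
      · exact hstep n k' (i + 1) hk' hi rfl
  obtain ⟨n, k', i, hk', rfl | ⟨hi, rfl⟩⟩ := key k
  · exact ⟨n, hk'⟩
  · rw [gPrefix_of_block hSH hk' hi.le] at h
    exact absurd h (not_le.2 (two_lt_curl_of_short_block hSH hi))

/-! ### Block prefixes of curling number one -/

theorem count_rulerPrefix (n : ℕ) : (rulerPrefix n).count 2 = n :=
  count_blocks two_notMem_rulerBlock n

/-- A digit `2` of `n` in base three forces a square at the end of the `n`-th block prefix. -/
theorem digit_ne_two_of_curl_le_one {n : ℕ} (h : curl (rulerPrefix n) ≤ 1) (v : ℕ) :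
    n / 3 ^ v % 3 ≠ 2 := by
  intro h2
  obtain ⟨M, hM⟩ : ∃ M, M = 3 ^ v := ⟨_, rfl⟩
  have hpos : 0 < M := by rw [hM]; positivity
  have hdm := Nat.div_add_mod n M
  have hlt := Nat.mod_lt n hpos
  obtain ⟨r, hr⟩ : ∃ r, n / M = 3 * r + 2 := ⟨n / M / 3, by rw [hM]; omega⟩
  rw [hr] at hdm
  obtain ⟨y, hy⟩ : ∃ y, y = n % M := ⟨_, rfl⟩
  rw [← hy] at hdm hlt
  have hn : n = M * (3 * r) + y + 2 * M := by linarith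
  have hsq := rulerPrefix_add_eq (e := M * (3 * r) + y) (j := M) ?_
  · rw [← hn] at hsq
    have := curl_le_one_iff.1 h _ _ hsq
    have hc := congrArg (List.count 2) this
    rw [count_blocks fun i => two_notMem_rulerBlock _] at hc
    simp at hc
    omega
  · intro i h1 hi
    rcases lt_trichotomy (y + i) M with hlt' | heq | hgt
    · rw [show M * (3 * r) + y + i = M * (3 * r) + (y + i) by ring,
        show M * (3 * r) + y + M + i = M * (3 * r + 1) + (y + i) by ring]
      exact padicValNat_add_eq (v := v) (by rw [hM]; exact dvd_mul_right _ _)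
        (by rw [hM]; exact dvd_mul_right _ _) (by omega) (by omega)
    · rw [show M * (3 * r) + y + i = M * (3 * r + 1) by linarith,
        show M * (3 * r) + y + M + i = M * (3 * r + 2) by linarith, hM,
        padicValNat_three_eq (by omega), padicValNat_three_eq (by omega)]
    · rw [show M * (3 * r) + y + i = M * (3 * r + 1) + (y + i - M) by
          rw [mul_add]; omega,
        show M * (3 * r) + y + M + i = M * (3 * r + 2) + (y + i - M) by
          rw [mul_add]; omega]
      exact padicValNat_add_eq (v := v) (by rw [hM]; exact dvd_mul_right _ _)
        (by rw [hM]; exact dvd_mul_right _ _) (by omega) (by omega)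

/-- When `n + 1` has no digit `2` in base three, a square at the end of its block prefix that
contains the separator has a root made of `3 ^ v` blocks, `v` the valuation of `n + 1`. -/
theorem square_root_block_count (hSH : StandingHyp) {n e j : ℕ} {U : List ℕ}
    (hdig : ∀ v, (n + 1) / 3 ^ v % 3 ≠ 2) (hj : j ≠ 0) (hn : n + 1 = e + 2 * j)
    (hU : rulerBlock (e + j) = rulerBlock (n + 1) ++ U)
    (hi : ∀ i, 1 ≤ i → i < j → rulerBlock (e + i) = rulerBlock (e + j + i)) :
    j = 3 ^ padicValNat 3 (n + 1) := by
  obtain ⟨w, hw, hw3⟩ := exists_eq_pow_mul hj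
  obtain ⟨v, hv⟩ : ∃ v, v = padicValNat 3 j := ⟨_, rfl⟩
  obtain ⟨M, hM⟩ : ∃ M, M = 3 ^ v := ⟨_, rfl⟩
  have hpos : 0 < M := by rw [hM]; positivity
  have hd := hdig v
  rw [← hv, ← hM] at hw
  rw [← hM] at hd
  have hdm := Nat.div_add_mod (n + 1) M
  have hlt := Nat.mod_lt (n + 1) hpos
  generalize (n + 1) / M = q at *
  obtain ⟨y, hy⟩ : ∃ y, y = (n + 1) % M := ⟨_, rfl⟩
  rw [← hy] at hdm hlt
  have hwq : 2 * w < q + 1 := by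
    refine lt_of_mul_lt_mul_left (a := M) ?_ hpos.le
    rw [mul_left_comm, ← hw, mul_add]
    omega
  obtain ⟨r, rfl⟩ : ∃ r, q = w + r := ⟨q - w, by omega⟩
  have hw1 : 1 ≤ w := by omega
  rw [mul_add, ← hw] at hdm
  have hMj : M ≤ j := by rw [hw]; exact Nat.le_mul_of_pos_right M hw1
  have hMr : M ≤ M * r := Nat.le_mul_of_pos_right M (by omega)
  have hdvd : ∀ a, M * 3 ∣ M * a ↔ 3 ∣ a := fun a => mul_dvd_mul_iff_left hpos.ne'
  have hM3 : M * 3 = 3 ^ (v + 1) := by rw [hM, pow_succ]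
  have hcongr : ∀ i, 1 ≤ i → i < j → ∀ a, e + i = M * a → (3 ∣ a ↔ 3 ∣ w + a) := by
    intro i h1 h2 a ha
    rw [← hdvd, ← hdvd, mul_add, ← hw, ← ha, hM3, show j + (e + i) = e + j + i by ring]
    exact dvd_iff_of_padicValNat_eq (by omega) (by omega)
      (padicValNat_eq_of_rulerBlock_eq hSH (hi i h1 h2)) _
  have hlow : 2 ≤ w → (3 ∣ r - 1 ↔ 3 ∣ w + (r - 1)) := by
    intro h2
    have hM2 : 2 * M ≤ j := by rw [hw, mul_comm]; exact Nat.mul_le_mul_left M h2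
    refine hcongr (j - y - M) (by omega) (by omega) _ ?_
    rw [Nat.mul_sub, mul_one]
    omega
  rcases Nat.eq_zero_or_pos y with rfl | hy0
  · have htop : 3 ∣ w + r → 3 ∣ r := by
      rw [← hdvd, ← hdvd, mul_add, ← hw, hM3, show j + M * r = n + 1 by omega,
        show M * r = e + j by omega, padicValNat_dvd_iff_le (by omega),
        padicValNat_dvd_iff_le (by omega)]
      exact fun h => h.trans (le_of_rulerBlock_eq_append hSH hU)
    obtain rfl : w = 1 := by
      by_contra hne
      have := hlow (by omega)
      omega
    rw [show n + 1 = 3 ^ v * (1 + r) by rw [← hM, mul_add]; omega,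
      padicValNat_three_eq (by omega), ← hM, hw, mul_one]
  · have htop := hcongr (j - y) (by omega) (by omega) r (by omega)
    by_cases h2 : 2 ≤ w
    · have := hlow h2
      omega
    · omega

theorem curl_rulerBlock_le_one {n : ℕ} (h : curl (rulerPrefix (n + 1)) ≤ 1) :
    curl (rulerBlock (n + 1)) ≤ 1 :=
  (curl_le_of_suffix ⟨rulerPrefix n ++ [2], by simp [rulerPrefix, blocks]⟩).trans h

/-- A square at the end of a block prefix whose block count has no digit `2` either lies in the
last block or splits a longer block in front of the last `3 ^ v` blocks. -/
theorem exists_split_of_not_curl_le_one (hSH : StandingHyp) {x : ℕ} (hx : x ≠ 0)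
    (hdig : ∀ v, x / 3 ^ v % 3 ≠ 2) (hT : curl (rulerBlock x) ≤ 1)
    (h : ¬curl (rulerPrefix x) ≤ 1) :
    ∃ e U, x = e + 2 * 3 ^ padicValNat 3 x ∧ U <:+ rulerPrefix e ∧ 2 ∉ U ∧
      rulerBlock (e + 3 ^ padicValNat 3 x) = rulerBlock x ++ U := by
  obtain ⟨n, rfl⟩ := Nat.exists_eq_succ_of_ne_zero hx
  rw [curl_le_one_iff] at h
  push Not at h
  obtain ⟨X, Y, hXY, hY0⟩ := h
  by_cases hY : 2 ∈ Y
  · obtain ⟨U, V, rfl, hU⟩ := List.eq_append_cons_of_mem hY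
    obtain ⟨e, he, hXU, hf, hi, -⟩ :=
      blocks_square two_notMem_rulerBlock (two_notMem_rulerBlock (n + 1)) hU rfl hXY
    have hj := square_root_block_count hSH hdig (by omega) he hf hi
    rw [Nat.succ_eq_add_one, ← hj]
    exact ⟨e, U, he, ⟨X, hXU⟩, hU, hf⟩
  · have hs : Y ++ Y <:+ rulerBlock (n + 1) :=
      suffix_of_notMem (A := rulerPrefix n) (c := 2) (by simp [hY]) ⟨X, by
        rw [← List.append_assoc, ← hXY]; rfl⟩
    obtain ⟨X', hX'⟩ := hs
    exact (hY0 (curl_le_one_iff.1 hT X' Y (by rw [List.append_assoc]; exact hX'.symm))).elim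

theorem curl_rulerPrefix_pow (hSH : StandingHyp) (a : ℕ)
    (hdig : ∀ v, 3 ^ a / 3 ^ v % 3 ≠ 2) :
    curl (rulerPrefix (3 ^ a)) ≤ 1 ↔ a ∈ Qset := by
  have hpos : 0 < 3 ^ a := by positivity
  have hb : rulerBlock (3 ^ a) = Tstr 2 (a + 1) := by
    rw [rulerBlock, padicValNat.prime_pow]
  have hQ : a ∈ Qset ↔ curl (rulerBlock (3 ^ a)) ≤ 1 := by
    rw [hb]
    exact ⟨fun h => h.le, fun h => le_antisymm h (one_le_curl _)⟩
  rw [hQ]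
  constructor
  · obtain ⟨n, hn⟩ := Nat.exists_eq_succ_of_ne_zero hpos.ne'
    rw [hn]
    exact curl_rulerBlock_le_one
  · intro h
    by_contra hc
    obtain ⟨e, U, he, -⟩ := exists_split_of_not_curl_le_one hSH hpos.ne' hdig h hc
    rw [padicValNat.prime_pow] at he
    omega

theorem curl_rulerPrefix_add (hSH : StandingHyp) {a b r : ℕ} (hab : a < b) (hr : ¬3 ∣ r)
    (hdig : ∀ v, (3 ^ b * r + 3 ^ a) / 3 ^ v % 3 ≠ 2) :
    curl (rulerPrefix (3 ^ b * r + 3 ^ a)) ≤ 1 ↔ (a, b) ∈ Rset := by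
  obtain ⟨M, hM⟩ : ∃ M, 3 ^ a = M + 1 := ⟨3 ^ a - 1, by
    have : 0 < 3 ^ a := by positivity
    omega⟩
  obtain ⟨d, rfl⟩ : ∃ d, b = a + 1 + d := ⟨b - a - 1, by omega⟩
  obtain ⟨u, hu⟩ : ∃ u, u + 1 = 3 ^ d * r := ⟨3 ^ d * r - 1, by
    have : 3 ^ d * r ≠ 0 := mul_ne_zero (by positivity) (by rintro rfl; simp at hr)
    omega⟩
  have hbr : 3 ^ (a + 1 + d) * r = 3 ^ a * (3 * u + 3) := by
    rw [pow_add, mul_assoc, ← hu]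
    ring
  obtain ⟨e, he⟩ : ∃ e, e = 3 ^ a * (3 * u + 2) := ⟨_, rfl⟩
  have hx : 3 ^ (a + 1 + d) * r + 3 ^ a = e + (M + 1) + M + 1 := by
    rw [hbr, add_assoc, add_assoc, ← hM, he]
    ring
  have hmid : e + M + 1 = 3 ^ (a + 1 + d) * r := by
    rw [add_assoc, ← hM, hbr, he]
    ring
  have be : rulerBlock e = Tstr 2 (a + 1) := by
    rw [rulerBlock, he, padicValNat_three_eq (by omega)]
  have bmid : rulerBlock (e + M + 1) = Tstr 2 (a + 1 + d + 1) := by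
    rw [rulerBlock, hmid, padicValNat_three_eq hr]
  have ox : padicValNat 3 (3 ^ (a + 1 + d) * r + 3 ^ a) = a := by
    rw [hbr, show 3 ^ a * (3 * u + 3) + 3 ^ a = 3 ^ a * (3 * u + 4) by ring,
      padicValNat_three_eq (by omega)]
  have bx : rulerBlock (3 ^ (a + 1 + d) * r + 3 ^ a) = Tstr 2 (a + 1) := by
    rw [rulerBlock, ox]
  have hQ : a ∈ Qset ↔ curl (Tstr 2 (a + 1)) ≤ 1 :=
    ⟨fun h => h.le, fun h => le_antisymm h (one_le_curl _)⟩
  constructor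
  · intro h
    rw [hx] at h bx
    refine ⟨hQ.2 (bx ▸ curl_rulerBlock_le_one h), hab, ?_⟩
    rintro ⟨S, ⟨V, hV⟩, hS⟩
    obtain ⟨e', rfl⟩ : ∃ e', e = e' + 1 := ⟨e - 1, by
      have : 0 < e := by rw [he]; positivity
      omega⟩
    have hblock : blocks 2 (fun i => rulerBlock (e' + 1 + (M + 1) + i)) M =
        blocks 2 (fun i => rulerBlock (e' + 1 + i)) M := by
      refine blocks_congr fun i h1 h2 => ?_
      have hde : 3 ^ a ∣ e' + 1 := he ▸ dvd_mul_right _ _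
      simp only [rulerBlock]
      rw [padicValNat_add_eq (v := a) (by rw [← hM]; exact dvd_add hde dvd_rfl) hde h1
        (by omega)]
    have hsq : rulerPrefix (e' + 1 + (M + 1) + M + 1) = rulerPrefix e' ++ 2 :: V ++
        (S ++ blocks 2 (fun i => rulerBlock (e' + 1 + i)) M ++ 2 :: Tstr 2 (a + 1)) ++
        (S ++ blocks 2 (fun i => rulerBlock (e' + 1 + i)) M ++ 2 :: Tstr 2 (a + 1)) := by
      rw [rulerPrefix, blocks, bx, blocks_add, hblock, ← add_assoc, blocks, bmid, blocks_add,
        blocks, be, ← hV, ← hS, ← hV]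
      simp [rulerPrefix]
    have := curl_le_one_iff.1 h _ _ hsq
    simp at this
  · rintro ⟨ha, -, hS⟩
    by_contra hc
    obtain ⟨e', U, he', hUe, hU, hf⟩ := exists_split_of_not_curl_le_one hSH
      (by omega) hdig (by rw [bx]; exact hQ.1 ha) hc
    rw [bx, ox, hM, ← add_assoc] at hf
    rw [ox, hM] at he'
    obtain rfl : e' = e := by omega
    refine hS ⟨U, ?_, ?_⟩
    · obtain ⟨e'', rfl⟩ : ∃ e'', e' = e'' + 1 := ⟨e' - 1, by
        have : 0 < e' := by rw [he]; positivity
        omega⟩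
      rw [rulerPrefix, blocks, be] at hUe
      exact suffix_of_notMem hU hUe
    · rw [← hf, bmid]

/-! ### The map `chi` and the image of `iota` -/

theorem digits_chi (a : ℕ) : Nat.digits 3 (chi 2 a) = Nat.digits 2 a := by
  refine Nat.digits_ofDigits 3 (by norm_num) _ (fun l hl => ?_) fun h => ?_
  · have := Nat.digits_lt_base (by norm_num) hl
    omega
  · exact Nat.getLast_digit_ne_zero 2 (Nat.digits_ne_nil_iff_ne_zero.1 h)

theorem digit_chi_ne_two (a v : ℕ) : chi 2 a / 3 ^ v % 3 ≠ 2 := by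
  rw [← Nat.getD_digits _ _ (by norm_num), digits_chi, Nat.getD_digits _ _ le_rfl]
  omega

theorem chi_two_mul (a : ℕ) : chi 2 (2 * a) = 3 * chi 2 a := by
  rcases Nat.eq_zero_or_pos a with rfl | ha
  · simp [chi]
  · rw [chi, Nat.digits_base_mul one_lt_two ha]
    simp [Nat.ofDigits_cons, chi]

theorem chi_two_mul_add_one (a : ℕ) : chi 2 (2 * a + 1) = 3 * chi 2 a + 1 := by
  rw [chi, add_comm (2 * a), Nat.digits_add 2 one_lt_two 1 a one_lt_two (.inl one_ne_zero)]
  simp [Nat.ofDigits_cons, chi, add_comm]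

theorem chi_two_pow_mul (k a : ℕ) : chi 2 (2 ^ k * a) = 3 ^ k * chi 2 a := by
  induction k with
  | zero => simp
  | succ k ih => rw [pow_succ', mul_assoc, chi_two_mul, ih, pow_succ', mul_assoc]

theorem mem_image_iota_iff (hSH : StandingHyp) (a : ℕ) :
    (∃ t, 1 ≤ t ∧ iota 1 t = a) ↔ curl (rulerPrefix (chi 2 a)) ≤ 1 := by
  constructor
  · rintro ⟨t, -, rfl⟩
    have hT := curl_Tstr_le hSH le_rfl t
    obtain ⟨x, hx⟩ := exists_rulerPrefix_eq hSH (hT.trans one_le_two)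
    have hxT : Tstr 1 t = rulerPrefix x := hx
    rw [hxT] at hT
    have hι : chi 2 (iota 1 t) = x := by
      rw [iota, hxT, count_rulerPrefix, chi, Nat.digits_ofDigits 2 (by norm_num),
        Nat.ofDigits_digits]
      · intro l hl
        obtain ⟨i, hi, rfl⟩ := List.mem_iff_getElem.1 hl
        have h3 := Nat.digits_lt_base (by norm_num) hl
        have h2 := digit_ne_two_of_curl_le_one hT i
        rw [← Nat.getD_digits _ _ (by norm_num), List.getD_eq_getElem _ _ hi] at h2
        omega
      · exact fun h => Nat.getLast_digit_ne_zero 3 (Nat.digits_ne_nil_iff_ne_zero.1 h)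
    rwa [hι]
  · intro h
    obtain ⟨k, hk⟩ := exists_gPrefix_eq hSH (chi 2 a)
    obtain ⟨v, hv⟩ := exists_tau_eq (m := 1) (hk ▸ h)
    refine ⟨v + 1, by omega, ?_⟩
    rw [iota, Tstr, hv, hk, count_rulerPrefix, digits_chi, Nat.ofDigits_digits]

/-- Corollary `the image of iota1`. (i) `0 ∈ Im(ι_1)`.
(ii) `2^{α₁} ∈ Im(ι_1)` iff `α₁ ∈ Q`. (iii) For `0 ≤ α₁ < α₂` and odd `λ ≥ 1`,
`λ·2^{α₂} + 2^{α₁} ∈ Im(ι_1)` iff `(α₁,α₂) ∈ R`. -/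
theorem statement7 (hSH : StandingHyp) :
    (∃ t : ℕ, 1 ≤ t ∧ iota 1 t = 0) ∧
    (∀ a : ℕ, (∃ t : ℕ, 1 ≤ t ∧ iota 1 t = 2 ^ a) ↔ a ∈ Qset) ∧
    (∀ a b lam : ℕ, a < b → Odd lam → 1 ≤ lam →
      ((∃ t : ℕ, 1 ≤ t ∧ iota 1 t = lam * 2 ^ b + 2 ^ a) ↔ (a, b) ∈ Rset)) := by
  
  refine ⟨?_, fun a => ?_, fun a b lam hab hodd _ => ?_⟩
  · rw [mem_image_iota_iff hSH, curl_le_one_iff]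
    intro X Y h
    simp_all [chi, rulerPrefix, blocks]
  · have hχ : chi 2 (2 ^ a) = 3 ^ a := by
      rw [← mul_one (2 ^ a), chi_two_pow_mul]
      simp [chi]
    rw [mem_image_iota_iff hSH, hχ]
    exact curl_rulerPrefix_pow hSH a fun v => hχ ▸ digit_chi_ne_two (2 ^ a) v
  · obtain ⟨k, rfl⟩ := hodd
    obtain ⟨d, rfl⟩ : ∃ d, b = a + d + 1 := ⟨b - a - 1, by omega⟩
    have hχ : chi 2 ((2 * k + 1) * 2 ^ (a + d + 1) + 2 ^ a) =
        3 ^ (a + d + 1) * (3 * chi 2 k + 1) + 3 ^ a := by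
      rw [show (2 * k + 1) * 2 ^ (a + d + 1) + 2 ^ a =
        2 ^ a * (2 * (2 ^ d * (2 * k + 1)) + 1) by ring, chi_two_pow_mul, chi_two_mul_add_one,
        chi_two_pow_mul, chi_two_mul_add_one]
      ring
    rw [mem_image_iota_iff hSH, hχ]
    exact curl_rulerPrefix_add hSH hab (by omega) fun v => hχ ▸ digit_chi_ne_two _ v
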